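/- Let Q be a finite acyclic quiver, K a field, and N, N' thin representations of Q such that the underlying graph of supp(N) contains no cycles. Then N ≅ N' if and only if supp(N) = supp(N'). -/

import Mathlib

open scoped Classical

namespace QR

/-- A finite quiver: finite sets of vertices and arrows with source and target maps. -/
structure FinQuiver where
  V : Type
  A : Type
  [fintypeV : Fintype V]
  [fintypeA : Fintype A]
  s : A → V
  t : A → V

attribute [instance] FinQuiver.fintypeV FinQuiver.fintypeA

/-- One oriented step along an arrow of `Q`. -/
def FinQuiver.Step (Q : FinQuiver) (v w : Q.V) : Prop := ∃ a : Q.A, Q.s a = v ∧ Q.t a = w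

/-- `Q` is acyclic: it contains no oriented cycle. -/
def FinQuiver.Acyclic (Q : FinQuiver) : Prop := ∀ v : Q.V, ¬ Relation.TransGen Q.Step v v

/-- A finite-dimensional `K`-linear representation of the quiver `Q`. -/
structure Rep (K : Type) [Field K] (Q : FinQuiver) where
  space : Q.V → Type
  [instAddCommGroup : ∀ v, AddCommGroup (space v)]
  [instModule : ∀ v, Module K (space v)]
  [instFinite : ∀ v, FiniteDimensional K (space v)]
  map : ∀ a : Q.A, space (Q.s a) →ₗ[K] space (Q.t a)

attribute [instance] Rep.instAddCommGroup Rep.instModule Rep.instFinite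

variable {K : Type} [Field K] {Q : FinQuiver}

/-- A morphism of representations: linear maps commuting with the structure maps. -/
structure Hom (N M : Rep K Q) where
  app : ∀ v, N.space v →ₗ[K] M.space v
  comm : ∀ a : Q.A, (M.map a).comp (app (Q.s a)) = (app (Q.t a)).comp (N.map a)

/-- Composition of morphisms of representations. -/
def Hom.comp {X Y Z : Rep K Q} (g : Hom Y Z) (f : Hom X Y) : Hom X Z where
  app v := (g.app v).comp (f.app v)
  comm a := by
    ext x
    have h1 := LinearMap.congr_fun (f.comm a) x
    have h2 := LinearMap.congr_fun (g.comm a) (f.app (Q.s a) x)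
    simp only [LinearMap.comp_apply] at h1 h2 ⊢
    rw [h2, h1]

/-- A representation is nonzero if some vertex space contains a nonzero vector. -/
def Rep.Nonzero (M : Rep K Q) : Prop := ∃ v, ∃ x : M.space v, x ≠ 0

/-- A representation is zero if all its vertex spaces are trivial. -/
def IsZeroRep (M : Rep K Q) : Prop := ∀ v, ∀ x : M.space v, x = 0

/-- Two representations are isomorphic iff there is a morphism between them that is
bijective at every vertex. -/
def Iso (N M : Rep K Q) : Prop := ∃ f : Hom N M, ∀ v, Function.Bijective (f.app v)

/-- The direct sum of two representations. -/
noncomputable def dsum (N N' : Rep K Q) : Rep K Q where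
  space v := N.space v × N'.space v
  map a := (N.map a).prodMap (N'.map a)

/-- A representation is indecomposable if it is nonzero and not isomorphic to the
direct sum of two nonzero representations. -/
def Indecomposable (M : Rep K Q) : Prop :=
  M.Nonzero ∧ ¬ ∃ N N' : Rep K Q, N.Nonzero ∧ N'.Nonzero ∧ Iso M (dsum N N')

/-- A representation is thin if all its vertex spaces have dimension at most one. -/
def Rep.Thin (M : Rep K Q) : Prop := ∀ v, Module.finrank K (M.space v) ≤ 1

/-- Vertices of the support of `M`. -/
def suppV (M : Rep K Q) : Set Q.V := {v | ∃ x : M.space v, x ≠ 0}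

/-- Arrows of the support of `M`. -/
def suppA (M : Rep K Q) : Set Q.A := {a | M.map a ≠ 0}

/-- Two vertices are adjacent in the underlying graph of the subquiver with arrow set
`SA` if some arrow of `SA` joins them (in either direction). -/
def AdjIn (Q : FinQuiver) (SA : Set Q.A) (v w : Q.V) : Prop :=
  ∃ a ∈ SA, (Q.s a = v ∧ Q.t a = w) ∨ (Q.s a = w ∧ Q.t a = v)

/-- The subquiver with vertex set `SV` and arrow set `SA` is connected: any two of its
vertices are joined by a walk using its arrows. -/
def ConnectedOn (Q : FinQuiver) (SV : Set Q.V) (SA : Set Q.A) : Prop :=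
  ∀ v ∈ SV, ∀ w ∈ SV, Relation.ReflTransGen (AdjIn Q SA) v w

/-- The underlying graph of the subquiver with arrow set `SA` contains a cycle:
there are pairwise distinct arrows `e 0, …, e n` in `SA` and pairwise distinct
vertices `v 0, …, v n` such that `e i` joins `v i` and `v (i+1)` (cyclically,
in either direction). -/
def HasCycle (Q : FinQuiver) (SA : Set Q.A) : Prop :=
  ∃ (n : ℕ) (e : Fin (n + 1) → Q.A) (v : Fin (n + 1) → Q.V),
    Function.Injective e ∧ (∀ i, e i ∈ SA) ∧ Function.Injective v ∧
    ∀ i : Fin (n + 1), (Q.s (e i) = v i ∧ Q.t (e i) = v (i + 1)) ∨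
      (Q.s (e i) = v (i + 1) ∧ Q.t (e i) = v i)

/-- The underlying graph of the subquiver `(SV, SA)` is a tree:
nonempty, connected and with no cycles. -/
def IsTreeOn (Q : FinQuiver) (SV : Set Q.V) (SA : Set Q.A) : Prop :=
  SV.Nonempty ∧ ConnectedOn Q SV SA ∧ ¬ HasCycle Q SA

/-- The underlying graph of the subquiver `(SV, SA)` is a cycle on `n + 1 ≥ 2` vertices. -/
def IsCycleOn (Q : FinQuiver) (SV : Set Q.V) (SA : Set Q.A) : Prop :=
  ∃ n : ℕ, 0 < n ∧ ∃ (ev : Fin (n + 1) → Q.V) (ea : Fin (n + 1) → Q.A),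
    Function.Injective ev ∧ Function.Injective ea ∧
    SV = Set.range ev ∧ SA = Set.range ea ∧
    ∀ i : Fin (n + 1), (Q.s (ea i) = ev i ∧ Q.t (ea i) = ev (i + 1)) ∨
      (Q.s (ea i) = ev (i + 1) ∧ Q.t (ea i) = ev i)

/-- The canonical representation of the subquiver `(SV, SA)`: the field `K` at the
vertices of `SV`, zero elsewhere, identity maps on the arrows of `SA` (realised as
submodules of `K` and inclusions), zero maps elsewhere. -/
noncomputable def canonical (K : Type) [Field K] (Q : FinQuiver)
    (SV : Set Q.V) (SA : Set Q.A) : Rep K Q where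
  space v := ↥(if v ∈ SV then (⊤ : Submodule K K) else ⊥)
  map a :=
    if a ∈ SA then
      (if h : (if Q.s a ∈ SV then (⊤ : Submodule K K) else ⊥) ≤
          (if Q.t a ∈ SV then (⊤ : Submodule K K) else ⊥)
        then Submodule.inclusion h else 0)
    else 0

/-- The simple representation `S(i)`. -/
noncomputable def simple (K : Type) [Field K] (Q : FinQuiver) (i : Q.V) : Rep K Q :=
  canonical K Q {i} ∅

/-- A family of submodules of the vertex spaces of `M` is a subrepresentation if it is
closed under the structure maps. -/
def IsSubRep (M : Rep K Q) (p : ∀ v, Submodule K (M.space v)) : Prop :=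
  ∀ a : Q.A, ∀ x ∈ p (Q.s a), M.map a x ∈ p (Q.t a)

/-- The representation carried by a subrepresentation of `M`. -/
noncomputable def restrictRep (M : Rep K Q) (p : ∀ v, Submodule K (M.space v)) : Rep K Q where
  space v := ↥(p v)
  map a :=
    if h : ∀ x ∈ p (Q.s a), M.map a x ∈ p (Q.t a) then (M.map a).restrict h else 0

/-- The quotient representation `M / p`. -/
noncomputable def quotRep (M : Rep K Q) (p : ∀ v, Submodule K (M.space v)) : Rep K Q where
  space v := M.space v ⧸ p v
  map a :=
    if h : p (Q.s a) ≤ (p (Q.t a)).comap (M.map a) then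
      Submodule.mapQ (p (Q.s a)) (p (Q.t a)) (M.map a) h
    else 0

/-- A length function on the category of finite-dimensional `K`-representations of `Q`:
nonnegative real valued, zero exactly on the zero representations, and additive on
short exact sequences. -/
def LengthFunction (l : Rep K Q → ℝ) : Prop :=
  (∀ X, 0 ≤ l X) ∧ (∀ X, l X = 0 ↔ IsZeroRep X) ∧
    ∀ (X Y Z : Rep K Q) (f : Hom X Y) (g : Hom Y Z),
      (∀ v, Function.Injective (f.app v)) →
      (∀ v, Function.Surjective (g.app v)) →
      (∀ v, LinearMap.range (f.app v) = LinearMap.ker (g.app v)) →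
      l Y = l X + l Z


/-- The lexicographic order on finite chains (= finite subsets) of `ℝ`:
`X ≤ₗ Y` iff `min (Y \ X) ≤ min (X \ Y)`, with the convention `min ∅ = ∞`. -/
def RLexLE (X Y : Finset ℝ) : Prop := (Y \ X).min ≤ (X \ Y).min

/-- `p` is an indecomposable subrepresentation of `M`. -/
def IndecSub (M : Rep K Q) (p : ∀ v, Submodule K (M.space v)) : Prop :=
  IsSubRep M p ∧ Indecomposable (restrictRep M p)

/-- `C` is a finite chain of indecomposable subrepresentations of `M`. -/
def IndecChain (M : Rep K Q) (C : Finset (∀ v, Submodule K (M.space v))) : Prop :=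
  (∀ p ∈ C, IndecSub M p) ∧ ∀ p ∈ C, ∀ q ∈ C, p ≤ q ∨ q ≤ p

/-- The values of the length function `l` on the members of a chain of
subrepresentations of `M`. -/
noncomputable def chainL (l : Rep K Q → ℝ) (M : Rep K Q)
    (C : Finset (∀ v, Submodule K (M.space v))) : Finset ℝ :=
  C.image fun p => l (restrictRep M p)

/-- An indecomposable filtration of `M`: a chain of indecomposable subrepresentations,
starting at a minimal (i.e. simple) one, each a direct predecessor of the next in the
poset of indecomposable subrepresentations, and ending at `M` itself. -/
def IndecFiltration (M : Rep K Q) {m : ℕ}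
    (𝒩 : Fin (m + 1) → ∀ v, Submodule K (M.space v)) : Prop :=
  (∀ i, IndecSub M (𝒩 i)) ∧
  (∀ r, IndecSub M r → r ≤ 𝒩 0 → r = 𝒩 0) ∧
  (∀ i : Fin m, 𝒩 i.castSucc ≤ 𝒩 i.succ ∧ 𝒩 i.castSucc ≠ 𝒩 i.succ ∧
    ∀ r, IndecSub M r → 𝒩 i.castSucc ≤ r → r ≤ 𝒩 i.succ →
      r = 𝒩 i.castSucc ∨ r = 𝒩 i.succ) ∧
  𝒩 (Fin.last m) = fun _ => ⊤

/-- `Z` is the Gabriel-Roiter measure `μ_l(M)`: the lexicographically greatest element of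
the set of `l`-values of finite chains of indecomposable subrepresentations of `M`
with maximum `M`. -/
def IsGRMeasure (l : Rep K Q → ℝ) (M : Rep K Q) (Z : Finset ℝ) : Prop :=
  (∃ C, IndecChain M C ∧ (fun _ => (⊤ : Submodule K _)) ∈ C ∧ chainL l M C = Z) ∧
  ∀ C, IndecChain M C → (fun _ => (⊤ : Submodule K _)) ∈ C → RLexLE (chainL l M C) Z

/-- `𝒩` is a GR filtration of `M` with respect to `l`: an indecomposable filtration
whose chain of `l`-values attains the Gabriel-Roiter measure of `M`. -/
def IsGRFiltration (l : Rep K Q → ℝ) (M : Rep K Q) {m : ℕ}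
    (𝒩 : Fin (m + 1) → ∀ v, Submodule K (M.space v)) : Prop :=
  IndecFiltration M 𝒩 ∧
    ∀ C, IndecChain M C → (fun _ => (⊤ : Submodule K _)) ∈ C →
      RLexLE (chainL l M C) (chainL l M (Finset.image 𝒩 Finset.univ))

/-- `(SV, SA)` is a subquiver of `Q`: arrows of `SA` have their endpoints in `SV`. -/
def IsSubquiver (Q : FinQuiver) (P : Set Q.V × Set Q.A) : Prop :=
  ∀ a ∈ P.2, Q.s a ∈ P.1 ∧ Q.t a ∈ P.1

/-- `P` is a member of `ℒ(Q)`, the poset of connected nonempty subquivers of `Q`. -/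
def InL (Q : FinQuiver) (P : Set Q.V × Set Q.A) : Prop :=
  IsSubquiver Q P ∧ P.1.Nonempty ∧ ConnectedOn Q P.1 P.2

/-- The order `≤_C` on subquivers: `P` is a subquiver of `P'` and every arrow of `P'`
whose source lies in `P` also has its target in `P`. -/
def leC (Q : FinQuiver) (P P' : Set Q.V × Set Q.A) : Prop :=
  P.1 ⊆ P'.1 ∧ P.2 ⊆ P'.2 ∧ ∀ a ∈ P'.2, Q.s a ∈ P.1 → Q.t a ∈ P.1

/-- The total weight of the vertices of a subquiver. -/
noncomputable def qweight (w : Q.V → ℝ) (P : Set Q.V × Set Q.A) : ℝ :=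
  ∑ v : Q.V, if v ∈ P.1 then w v else 0

/-- `C` is a finite chain in the poset `ℒ(Q)`. -/
def LChain (Q : FinQuiver) (C : Finset (Set Q.V × Set Q.A)) : Prop :=
  (∀ P ∈ C, InL Q P) ∧ ∀ P ∈ C, ∀ P' ∈ C, leC Q P P' ∨ leC Q P' P

/-- The weights of the members of a chain of subquivers. -/
noncomputable def qchainW (w : Q.V → ℝ) (C : Finset (Set Q.V × Set Q.A)) : Finset ℝ :=
  C.image (qweight w)

/-- A filtration in the poset `ℒ(Q)`: starting at a minimal connected subquiver, each
member a direct predecessor of the next one. -/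
def LFiltration (Q : FinQuiver) {m : ℕ} (𝒬 : Fin (m + 1) → Set Q.V × Set Q.A) : Prop :=
  (∀ i, InL Q (𝒬 i)) ∧
  (∀ P, InL Q P → leC Q P (𝒬 0) → P = 𝒬 0) ∧
  ∀ i : Fin m, leC Q (𝒬 i.castSucc) (𝒬 i.succ) ∧ 𝒬 i.castSucc ≠ 𝒬 i.succ ∧
    ∀ P, InL Q P → leC Q (𝒬 i.castSucc) P → leC Q P (𝒬 i.succ) →
      P = 𝒬 i.castSucc ∨ P = 𝒬 i.succ

/-- `Z` is the value `w*(P₀)` of the induced chain length function of the weight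
function `w` in the poset `ℒ(Q)`. -/
def IsWStar (Q : FinQuiver) (w : Q.V → ℝ) (P₀ : Set Q.V × Set Q.A) (Z : Finset ℝ) : Prop :=
  (∃ C, LChain Q C ∧ (P₀ ∈ C ∧ ∀ P ∈ C, leC Q P P₀) ∧ qchainW w C = Z) ∧
  ∀ C, LChain Q C → (P₀ ∈ C ∧ ∀ P ∈ C, leC Q P P₀) → RLexLE (qchainW w C) Z

/-- `𝒬` is a `w*`-filtration of `P₀` in the poset `ℒ(Q)`. -/
def IsWStarLFiltration (Q : FinQuiver) (w : Q.V → ℝ) {m : ℕ}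
    (𝒬 : Fin (m + 1) → Set Q.V × Set Q.A) (P₀ : Set Q.V × Set Q.A) : Prop :=
  LFiltration Q 𝒬 ∧ 𝒬 (Fin.last m) = P₀ ∧
    ∀ C, LChain Q C → (P₀ ∈ C ∧ ∀ P ∈ C, leC Q P P₀) →
      RLexLE (qchainW w C) (qchainW w (Finset.image 𝒬 Finset.univ))

/-- `E` is an injective object in the category of finite-dimensional
`K`-representations of `Q`. -/
def InjectiveRep (E : Rep K Q) : Prop :=
  ∀ (X Y : Rep K Q) (f : Hom X Y), (∀ v, Function.Injective (f.app v)) →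
    ∀ g : Hom X E, ∃ h : Hom Y E, Hom.comp h f = g

end QR

namespace QR

section Support

variable {K : Type} [Field K] {Q : FinQuiver}

/-- The simple graph underlying the subquiver with arrow set `SA`. -/
def underlyingGraph (Q : FinQuiver) (SA : Set Q.A) : SimpleGraph Q.V :=
  SimpleGraph.fromRel (AdjIn Q SA)

lemma adjIn_of_underlyingGraph_adj {SA : Set Q.A} {v w : Q.V}
    (h : (underlyingGraph Q SA).Adj v w) : AdjIn Q SA v w := by
  obtain ⟨-, h | ⟨a, ha, h⟩⟩ := (SimpleGraph.fromRel_adj _ _ _).1 h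
  · exact h
  · exact ⟨a, ha, h.symm⟩

lemma underlyingGraph_reachable {SA : Set Q.A} {a : Q.A} (ha : a ∈ SA) :
    (underlyingGraph Q SA).Reachable (Q.s a) (Q.t a) := by
  by_cases h : Q.s a = Q.t a
  · rw [h]
  · exact SimpleGraph.Adj.reachable
      ((SimpleGraph.fromRel_adj _ _ _).2 ⟨h, Or.inl ⟨a, ha, Or.inl ⟨rfl, rfl⟩⟩⟩)

lemma HasCycle.mono {SA SA' : Set Q.A} (h : SA ⊆ SA') (hc : HasCycle Q SA) : HasCycle Q SA' := by
  obtain ⟨n, e, v, he, heS, hv, hev⟩ := hc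
  exact ⟨n, e, v, he, fun i => h (heS i), hv, hev⟩

/-- A new arrow whose endpoints are already joined by a walk closes a cycle. -/
lemma hasCycle_insert {SA : Set Q.A} {a : Q.A} (ha : a ∉ SA)
    (hr : (underlyingGraph Q SA).Reachable (Q.t a) (Q.s a)) : HasCycle Q (insert a SA) := by
  obtain ⟨p, hp⟩ := hr.exists_isPath
  have hinj : ∀ i j, i ≤ p.length → j ≤ p.length → p.getVert i = p.getVert j → i = j :=
    fun i j hi hj h => hp.getVert_injOn hi hj h
  choose f hfS hf using fun i : {i : ℕ // i < p.length} =>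
    adjIn_of_underlyingGraph_adj (p.adj_getVert_succ i.2)
  refine ⟨p.length, fun i => if h : i.1 < p.length then f ⟨i, h⟩ else a,
    fun i => p.getVert i, ?_, ?_, ?_, ?_⟩
  · intro i j hij
    dsimp only at hij
    split_ifs at hij with hi hj hj
    · have h1 := hf ⟨i, hi⟩
      have h2 := hf ⟨j, hj⟩
      rw [← hij] at h2
      dsimp only at h1 h2
      have k1 := hinj i j (by omega) (by omega)
      have k2 := hinj i (j + 1) (by omega) (by omega)
      have k3 := hinj (i + 1) j (by omega) (by omega)
      ext
      grind
    · exact absurd (hij ▸ hfS _) ha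
    · exact absurd (hij ▸ hfS _) ha
    · ext; omega
  · intro i
    dsimp only
    split_ifs with hi
    · exact Or.inr (hfS _)
    · exact Or.inl rfl
  · intro i j hij
    exact Fin.ext (hinj i j (by omega) (by omega) hij)
  · intro i
    dsimp only
    split_ifs with hi
    · have : ((i + 1 : Fin (p.length + 1)) : ℕ) = i + 1 :=
        Fin.val_add_one_of_lt (Fin.lt_def.2 (by simpa using hi))
      rw [this]
      exact hf ⟨i, hi⟩
    · have : i = Fin.last _ := Fin.ext (by simp; omega)
      subst this
      simp

/-- On a subquiver without cycles, every family of units on the arrows is a coboundary. -/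
lemma exists_units_of_not_hasCycle (c : Q.A → Kˣ) (S : Finset Q.A)
    (hS : ¬ HasCycle Q (S : Set Q.A)) :
    ∃ r : Q.V → Kˣ, ∀ a ∈ S, r (Q.s a) = r (Q.t a) * c a := by
  induction S using Finset.induction_on with
  | empty => exact ⟨fun _ => 1, by simp⟩
  | insert a S ha ih =>
    rw [Finset.coe_insert] at hS
    obtain ⟨r, hr⟩ := ih fun h => hS (h.mono (Set.subset_insert _ _))
    have hnr : ¬ (underlyingGraph Q (S : Set Q.A)).Reachable (Q.t a) (Q.s a) :=
      fun h => hS (hasCycle_insert (by simpa using ha) h)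
    refine ⟨fun v => if (underlyingGraph Q (S : Set Q.A)).Reachable (Q.t a) v
      then r v * (r (Q.s a) / (r (Q.t a) * c a)) else r v, fun b hb => ?_⟩
    rcases Finset.mem_insert.1 hb with rfl | hb
    · beta_reduce
      rw [if_neg hnr, if_pos (SimpleGraph.Reachable.refl _), div_eq_mul_inv, mul_inv]
      rw [show ∀ x y z : Kˣ, x * (y * (x⁻¹ * z⁻¹)) * z = y * (x * x⁻¹) * (z * z⁻¹) from
        fun x y z => by ac_rfl]
      simp
    · have hb' := underlyingGraph_reachable (Q := Q) (SA := (S : Set Q.A)) (a := b) hb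
      have hiff : (underlyingGraph Q (S : Set Q.A)).Reachable (Q.t a) (Q.s b) ↔
          (underlyingGraph Q (S : Set Q.A)).Reachable (Q.t a) (Q.t b) :=
        ⟨fun h => h.trans hb', fun h => h.trans hb'.symm⟩
      simp only [hiff]
      split_ifs
      · rw [hr b hb, mul_right_comm]
      · exact hr b hb

/-- Nonzero maps between spaces of dimension at most one are proportional. -/
lemma exists_unit_smul_eq {V W : Type*} [AddCommGroup V] [Module K V] [FiniteDimensional K V]
    [AddCommGroup W] [Module K W] [FiniteDimensional K W]
    (hV : Module.finrank K V ≤ 1) (hW : Module.finrank K W ≤ 1)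
    {f g : V →ₗ[K] W} (hf : f ≠ 0) (hg : g ≠ 0) : ∃ c : Kˣ, f = c • g := by
  have : Nontrivial (V →ₗ[K] W) := ⟨f, 0, hf⟩
  have hle : Module.finrank K (V →ₗ[K] W) ≤ 1 := by
    rw [Module.finrank_linearMap]
    exact Nat.mul_le_mul hV hW
  obtain ⟨c, hc⟩ := exists_smul_eq_of_finrank_eq_one
    (le_antisymm hle Module.finrank_pos) hg f
  have hc0 : c ≠ 0 := by
    rintro rfl
    exact hf (by rw [← hc, zero_smul])
  exact ⟨Units.mk0 c hc0, hc.symm⟩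

lemma Rep.Thin.finrank_eq {M : Rep K Q} (hM : M.Thin) (v : Q.V) :
    Module.finrank K (M.space v) = if v ∈ suppV M then 1 else 0 := by
  split_ifs with h
  · obtain ⟨x, hx⟩ := h
    have : Nontrivial (M.space v) := ⟨x, 0, hx⟩
    exact le_antisymm (hM v) Module.finrank_pos
  · have : Subsingleton (M.space v) := subsingleton_of_forall_eq 0 fun x => by
      by_contra hx
      exact h ⟨x, hx⟩
    exact Module.finrank_zero_of_subsingleton

lemma Iso.suppV_eq {N M : Rep K Q} (h : Iso N M) : suppV N = suppV M := by
  obtain ⟨f, hf⟩ := h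
  ext v
  constructor
  · rintro ⟨x, hx⟩
    exact ⟨f.app v x, fun h => hx ((hf v).1 (h.trans (map_zero _).symm))⟩
  · rintro ⟨y, hy⟩
    obtain ⟨x, rfl⟩ := (hf v).2 y
    exact ⟨x, fun h => hy (by rw [h, map_zero])⟩

lemma Iso.suppA_eq {N M : Rep K Q} (h : Iso N M) : suppA N = suppA M := by
  obtain ⟨f, hf⟩ := h
  ext a
  refine not_congr ⟨fun h => ?_, fun h => ?_⟩
  · have hc := f.comm a
    rw [h, LinearMap.comp_zero] at hc
    ext y
    obtain ⟨x, rfl⟩ := (hf _).2 y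
    exact LinearMap.congr_fun hc x
  · have hc := f.comm a
    rw [h, LinearMap.zero_comp] at hc
    ext x
    exact (hf _).1 ((LinearMap.congr_fun hc x).symm.trans (map_zero _).symm)

lemma Rep.Thin.iso_of_supp_eq {N N' : Rep K Q} (hN : N.Thin) (hN' : N'.Thin)
    (hnocyc : ¬ HasCycle Q (suppA N)) (hV : suppV N = suppV N') (hA : suppA N = suppA N') :
    Iso N N' := by
  have φ : ∀ v, N.space v ≃ₗ[K] N'.space v := fun v =>
    LinearEquiv.ofFinrankEq _ _ (by rw [hN.finrank_eq, hN'.finrank_eq, hV])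
  have hzero : ∀ a ∉ suppA N, N.map a = 0 ∧ N'.map a = 0 := fun a ha =>
    ⟨not_not.1 ha, not_not.1 fun h => ha (hA.symm.subset h)⟩
  have hc : ∀ a : Q.A, ∃ c : Kˣ, (φ (Q.t a)).toLinearMap.comp (N.map a) =
      c • (N'.map a).comp (φ (Q.s a)).toLinearMap := fun a => by
    by_cases ha : a ∈ suppA N
    · refine exists_unit_smul_eq (hN _) (hN' _) (fun h => ha ?_) (fun h => (hA ▸ ha) ?_)
      · ext x
        exact (φ _).injective (by simpa using LinearMap.congr_fun h x)
      · ext y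
        simpa using LinearMap.congr_fun h ((φ _).symm y)
    · obtain ⟨h1, h2⟩ := hzero a ha
      exact ⟨1, by rw [h1, h2, LinearMap.comp_zero, LinearMap.zero_comp, smul_zero]⟩
  choose c hc using hc
  obtain ⟨r, hr⟩ := exists_units_of_not_hasCycle c (suppA N).toFinset (by simpa using hnocyc)
  refine ⟨⟨fun v => (r v : K) • (φ v).toLinearMap, fun a => ?_⟩, fun v => ?_⟩
  · by_cases ha : a ∈ suppA N
    · rw [LinearMap.comp_smul, LinearMap.smul_comp, hc a, hr a (by simpa using ha),
        Units.smul_def, smul_smul, Units.val_mul]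
    · obtain ⟨h1, h2⟩ := hzero a ha
      rw [h1, h2, LinearMap.comp_zero, LinearMap.zero_comp]
  · exact (MulAction.bijective (r v)).comp (φ v).bijective

end Support

end QR

theorem stmt7 (K : Type) [Field K] (Q : QR.FinQuiver) (hQ : Q.Acyclic)
    (N N' : QR.Rep K Q) (hN : N.Thin) (hN' : N'.Thin)
    (hnocyc : ¬ QR.HasCycle Q (QR.suppA N)) :
    QR.Iso N N' ↔ (QR.suppV N = QR.suppV N' ∧ QR.suppA N = QR.suppA N') := by
  exact ⟨fun h => ⟨h.suppV_eq, h.suppA_eq⟩, fun h => hN.iso_of_supp_eq hN' hnocyc h.1 h.2⟩
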